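/- arXiv:1907.11307 — 2 statements merged into one kernel-verified Lean document; each statement's English description precedes it below -/
import Mathlib

section
/- Let T ≥ 1, η > 0, β₂ ∈ (0,1), ε₀ ∈ (0,1), and set γ₁ = (1−ε₀)/√β₂; assume γ₁ < 1. Let g_1,…,g_T be nonzero reals, let (β_{1,t})_{t=1}^{T} satisfy ε₀ ≤ β_{1,t} ≤ 1, define m_0 = 0 and m_t = (1−β_{1,t})·m_{t−1} + β_{1,t}·g_t for t ≥ 1, and define v_0 = 0 and v_t = β₂·v_{t−1} + (1−β₂)·g_t² for t ≥ 1. Let (η̂_t)_{t=1}^{T} satisfy 0 ≤ η̂_t ≤ η/√t. Then Σ_{t=1}^{T} (η̂_t/(2β_{1,t}))·m_t²/√(v_t) ≤ (η·√(1+log T)/(2·ε₀²·(1−γ₁)·√(1−β₂)))·√(Σ_{t=1}^{T} g_t²). -/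
/-- One step of the momentum recursion: the ratio of the squared first moment to the root of the
second moment contracts by the factor `(1 - ε) / √β₂`, up to a multiple of the new gradient. -/
lemma momentum_ratio_step {β₂ ε b g m x : ℝ} (hβ₂ : 0 < β₂) (hβ₂' : β₂ < 1) (hε : 0 ≤ ε)
    (hb : ε ≤ b) (hb' : b ≤ 1) (hg : g ≠ 0) (hx : 0 ≤ x) (hmx : m ≠ 0 → 0 < x) :
    ((1 - b) * m + b * g) ^ 2 / √(β₂ * x + (1 - β₂) * g ^ 2) ≤
      (1 - ε) / √β₂ * (m ^ 2 / √x) + |g| / √(1 - β₂) := by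
  have h1 : 0 < 1 - β₂ := sub_pos.2 hβ₂'
  have hg2 : 0 < g ^ 2 := by positivity
  have hb0 : 0 ≤ b := hε.trans hb
  set y := β₂ * x + (1 - β₂) * g ^ 2 with hy
  have hy0 : 0 < y := by positivity
  have hsy : 0 < √y := Real.sqrt_pos.2 hy0
  have hconv : ((1 - b) * m + b * g) ^ 2 ≤ (1 - b) * m ^ 2 + b * g ^ 2 := by
    nlinarith [mul_nonneg (mul_nonneg hb0 (sub_nonneg.2 hb')) (sq_nonneg (m - g))]
  have hm : m ^ 2 / √y ≤ m ^ 2 / (√β₂ * √x) := by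
    rcases eq_or_ne m 0 with rfl | hm
    · simp
    · have hx0 := hmx hm
      rw [← Real.sqrt_mul hβ₂.le]
      gcongr
      rw [hy]
      have : 0 ≤ (1 - β₂) * g ^ 2 := by positivity
      linarith
  have hgy : g ^ 2 / √y ≤ |g| / √(1 - β₂) := by
    have hle : √(1 - β₂) * |g| ≤ √y := by
      rw [← Real.sqrt_sq_eq_abs, ← Real.sqrt_mul h1.le]
      apply Real.sqrt_le_sqrt
      have : 0 ≤ β₂ * x := by positivity
      linarith
    rw [div_le_div_iff₀ hsy (Real.sqrt_pos.2 h1), ← sq_abs]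
    nlinarith [mul_le_mul_of_nonneg_left hle (abs_nonneg g)]
  have hA : 0 ≤ m ^ 2 / (√β₂ * √x) := by positivity
  have hB : 0 ≤ |g| / √(1 - β₂) := by positivity
  calc ((1 - b) * m + b * g) ^ 2 / √y
      ≤ ((1 - b) * m ^ 2 + b * g ^ 2) / √y := by gcongr
    _ = (1 - b) * (m ^ 2 / √y) + b * (g ^ 2 / √y) := by ring
    _ ≤ (1 - ε) * (m ^ 2 / (√β₂ * √x)) + 1 * (|g| / √(1 - β₂)) := by
        have : 0 ≤ 1 - ε := sub_nonneg.2 (hb.trans hb')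
        gcongr
    _ = (1 - ε) / √β₂ * (m ^ 2 / √x) + |g| / √(1 - β₂) := by
        rw [one_mul, div_mul_div_comm, mul_div_assoc]

/-- A discrete Gronwall-type estimate with nonincreasing weights. -/
lemma weighted_sum_le_of_contraction {T : ℕ} {γ : ℝ} {a w c : ℕ → ℝ} (hγ : 0 ≤ γ)
    (ha0 : a 0 = 0) (ha : ∀ t, 0 ≤ a t) (hw : ∀ t, 0 ≤ w t)
    (hanti : ∀ t, 1 ≤ t → w (t + 1) ≤ w t)
    (hstep : ∀ t ∈ Finset.Icc 1 T, a t ≤ γ * a (t - 1) + c t) :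
    (1 - γ) * ∑ t ∈ Finset.Icc 1 T, w t * a t ≤ ∑ t ∈ Finset.Icc 1 T, w t * c t := by
  have key : ∀ n ≤ T, (1 - γ) * ∑ t ∈ Finset.Icc 1 n, w t * a t + γ * (w n * a n) ≤
      ∑ t ∈ Finset.Icc 1 n, w t * c t := by
    intro n
    induction n with
    | zero => simp [ha0]
    | succ n ih =>
      intro hn
      rw [Finset.sum_Icc_succ_top (by omega), Finset.sum_Icc_succ_top (by omega)]
      have hs := mul_le_mul_of_nonneg_left
        (hstep (n + 1) (Finset.mem_Icc.2 ⟨by omega, hn⟩)) (hw (n + 1))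
      rw [Nat.add_sub_cancel] at hs
      have hmono : w (n + 1) * a n ≤ w n * a n := by
        rcases Nat.eq_zero_or_pos n with rfl | hpos
        · simp [ha0]
        · exact mul_le_mul_of_nonneg_right (hanti n hpos) (ha n)
      have := mul_le_mul_of_nonneg_left hmono hγ
      linarith [ih (by omega)]
  have := mul_nonneg hγ (mul_nonneg (hw T) (ha T))
  linarith [key T le_rfl]

lemma sum_abs_div_sqrt_le (T : ℕ) (g : ℕ → ℝ) :
    ∑ t ∈ Finset.Icc 1 T, 1 / √(t : ℝ) * |g t| ≤
      √(1 + Real.log T) * √(∑ t ∈ Finset.Icc 1 T, g t ^ 2) := by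
  refine (Real.sum_mul_le_sqrt_mul_sqrt _ _ _).trans ?_
  simp only [sq_abs]
  gcongr
  have h := harmonic_le_one_add_log T
  rw [harmonic_eq_sum_Icc] at h
  push_cast at h
  refine le_of_eq_of_le (Finset.sum_congr rfl fun t _ => ?_) h
  rw [div_pow, Real.sq_sqrt t.cast_nonneg, one_pow, one_div]


/-- Bound on the last sum (term (11)) in the proof of Theorem 1 (DEAM),
adaptation of Lemma 2 of the AMSGrad paper to adaptive momentum weights. -/
theorem deam_last_sum_bound
    (T : ℕ) (hT : 1 ≤ T) (η β₂ ε₀ γ₁ : ℝ) (hη : 0 < η)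
    (hβ₂ : β₂ ∈ Set.Ioo (0 : ℝ) 1) (hε₀ : ε₀ ∈ Set.Ioo (0 : ℝ) 1)
    (hγ₁def : γ₁ = (1 - ε₀) / Real.sqrt β₂) (hγ₁ : γ₁ < 1)
    (g β ηhat m v : ℕ → ℝ)
    (hg : ∀ t ∈ Finset.Icc 1 T, g t ≠ 0)
    (hβ : ∀ t ∈ Finset.Icc 1 T, ε₀ ≤ β t ∧ β t ≤ 1)
    (hm0 : m 0 = 0)
    (hm : ∀ t ∈ Finset.Icc 1 T, m t = (1 - β t) * m (t - 1) + β t * g t)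
    (hv0 : v 0 = 0)
    (hv : ∀ t ∈ Finset.Icc 1 T, v t = β₂ * v (t - 1) + (1 - β₂) * (g t) ^ 2)
    (hηhat : ∀ t ∈ Finset.Icc 1 T, 0 ≤ ηhat t ∧ ηhat t ≤ η / Real.sqrt t) :
    ∑ t ∈ Finset.Icc 1 T, (ηhat t / (2 * β t)) * (m t) ^ 2 / Real.sqrt (v t) ≤
      η * Real.sqrt (1 + Real.log T) / (2 * ε₀ ^ 2 * (1 - γ₁) * Real.sqrt (1 - β₂))
        * Real.sqrt (∑ t ∈ Finset.Icc 1 T, (g t) ^ 2) := by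
  obtain ⟨hβ₂0, hβ₂1⟩ := hβ₂
  obtain ⟨hε0, hε1⟩ := hε₀
  have h1 : 0 < 1 - β₂ := sub_pos.2 hβ₂1
  have hγ0 : 0 ≤ γ₁ := hγ₁def ▸ div_nonneg (sub_nonneg.2 hε1.le) (Real.sqrt_nonneg _)
  have hv_nonneg : ∀ t ≤ T, 0 ≤ v t := by
    intro t
    induction t with
    | zero => simp [hv0]
    | succ n ih =>
      intro hn
      have := ih (by omega)
      rw [hv (n + 1) (Finset.mem_Icc.2 ⟨by omega, hn⟩), Nat.add_sub_cancel]
      positivity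
  have hv_pos : ∀ t ∈ Finset.Icc 1 T, 0 < v t := by
    intro t ht
    have hgt := hg t ht
    have := hv_nonneg (t - 1) (by have := Finset.mem_Icc.1 ht; omega)
    rw [hv t ht]
    positivity
  have hstep : ∀ t ∈ Finset.Icc 1 T, m t ^ 2 / √(v t) ≤
      γ₁ * (m (t - 1) ^ 2 / √(v (t - 1))) + |g t| / √(1 - β₂) := by
    intro t ht
    have htT := Finset.mem_Icc.1 ht
    rw [hm t ht, hv t ht, hγ₁def]
    refine momentum_ratio_step hβ₂0 hβ₂1 hε0.le (hβ t ht).1 (hβ t ht).2 (hg t ht)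
      (hv_nonneg _ (by omega)) fun hne => hv_pos _ (Finset.mem_Icc.2 ⟨?_, by omega⟩)
    exact Nat.one_le_iff_ne_zero.2 fun h0 => hne (h0 ▸ hm0)
  have hsum := weighted_sum_le_of_contraction (a := fun t => m t ^ 2 / √(v t))
    (w := fun t => 1 / √(t : ℝ)) (c := fun t => |g t| / √(1 - β₂)) hγ0 (by simp [hm0])
    (fun t => by positivity) (fun t => by positivity)
    (fun t ht => by
      have : (0 : ℝ) < t := by exact_mod_cast ht
      gcongr
      omega) hstep
  have hS : ∑ t ∈ Finset.Icc 1 T, 1 / √(t : ℝ) * (m t ^ 2 / √(v t)) ≤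
      √(1 + Real.log T) * √(∑ t ∈ Finset.Icc 1 T, g t ^ 2) / ((1 - γ₁) * √(1 - β₂)) := by
    rw [le_div_iff₀ (mul_pos (sub_pos.2 hγ₁) (Real.sqrt_pos.2 h1))]
    simp only [← mul_div_assoc, ← Finset.sum_div] at hsum ⊢
    rw [← mul_assoc, mul_comm _ (1 - γ₁), ← le_div_iff₀ (Real.sqrt_pos.2 h1)]
    refine hsum.trans ?_
    gcongr
    exact sum_abs_div_sqrt_le T g
  calc ∑ t ∈ Finset.Icc 1 T, ηhat t / (2 * β t) * m t ^ 2 / √(v t)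
      ≤ ∑ t ∈ Finset.Icc 1 T, η / (2 * ε₀) * (1 / √(t : ℝ) * (m t ^ 2 / √(v t))) := by
        refine Finset.sum_le_sum fun t ht => ?_
        have hle : ηhat t / (2 * β t) ≤ η / √(t : ℝ) / (2 * ε₀) := by
          gcongr
          · exact (hηhat t ht).2
          · exact (hβ t ht).1
        calc ηhat t / (2 * β t) * m t ^ 2 / √(v t)
            = ηhat t / (2 * β t) * (m t ^ 2 / √(v t)) := mul_div_assoc ..
          _ ≤ η / √(t : ℝ) / (2 * ε₀) * (m t ^ 2 / √(v t)) := by gcongr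
          _ = η / (2 * ε₀) * (1 / √(t : ℝ) * (m t ^ 2 / √(v t))) := by ring
    _ ≤ η / (2 * ε₀ ^ 2) *
        (√(1 + Real.log T) * √(∑ t ∈ Finset.Icc 1 T, g t ^ 2) / ((1 - γ₁) * √(1 - β₂))) := by
        rw [← Finset.mul_sum]
        have hsq : ε₀ ^ 2 ≤ ε₀ := by nlinarith
        have hnn : 0 ≤ ∑ t ∈ Finset.Icc 1 T, 1 / √(t : ℝ) * (m t ^ 2 / √(v t)) :=
          Finset.sum_nonneg fun t _ => by positivity
        gcongr
    _ = _ := by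
        rw [div_mul_div_comm, div_mul_eq_mul_div]
        congr 1 <;> ring
end

section
/- Let t ≥ 1, b ∈ (0,1], c ≥ 0, and let a_1,…,a_t be nonnegative reals with Σ_{j=1}^{t} b^{t−j}·a_j > 0. Then (Σ_{j=1}^{t} c^{t−j}·a_j) / √(Σ_{j=1}^{t} b^{t−j}·a_j) ≤ Σ_{j=1}^{t} (c/√b)^{t−j}·√(a_j). -/
/-- Estimate bounding m_t²/√(v_t) by a geometric sum, used in the proof of
Theorem 1 (DEAM). -/
theorem deam_ratio_geometric_bound
    (t : ℕ) (ht : 1 ≤ t) (b c : ℝ) (hb : b ∈ Set.Ioc (0 : ℝ) 1) (hc : 0 ≤ c)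
    (a : ℕ → ℝ) (ha : ∀ j ∈ Finset.Icc 1 t, 0 ≤ a j)
    (hpos : 0 < ∑ j ∈ Finset.Icc 1 t, b ^ (t - j) * a j) :
    (∑ j ∈ Finset.Icc 1 t, c ^ (t - j) * a j) /
        Real.sqrt (∑ j ∈ Finset.Icc 1 t, b ^ (t - j) * a j) ≤
      ∑ j ∈ Finset.Icc 1 t, (c / Real.sqrt b) ^ (t - j) * Real.sqrt (a j) := by
  have hsb : 0 < √b := Real.sqrt_pos.2 hb.1
  rw [Finset.sum_div]
  refine Finset.sum_le_sum fun j hj => ?_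
  rw [div_le_iff₀ (Real.sqrt_pos.2 hpos)]
  have hterm : √b ^ (t - j) * √(a j) ≤ √(∑ i ∈ Finset.Icc 1 t, b ^ (t - i) * a i) := by
    refine Real.le_sqrt_of_sq_le ?_
    rw [mul_pow, pow_right_comm, Real.sq_sqrt hb.1.le, Real.sq_sqrt (ha j hj)]
    exact Finset.single_le_sum (f := fun i => b ^ (t - i) * a i)
      (fun i hi => mul_nonneg (pow_nonneg hb.1.le _) (ha i hi)) hj
  calc c ^ (t - j) * a j
      = (c / √b) ^ (t - j) * √(a j) * (√b ^ (t - j) * √(a j)) := by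
        rw [mul_mul_mul_comm, ← mul_pow, div_mul_cancel₀ _ hsb.ne', Real.mul_self_sqrt (ha j hj)]
    _ ≤ _ := by gcongr
end
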